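/- Let η ∈ ℂ, η ≠ 0, and μ ∈ ℂ with μ ≠ 1. Let x = (x_1,…,x_M) and y = (y_1,…,y_N) be tuples of complex numbers, each pairwise distinct, with x_a ≠ y_b for all a, b. Then 𝒜^{+}_{y}[μE^{−}_{x}] = (1−μ)^{N−M}·𝒜^{−}_{x}[μE^{+}_{y}]. Moreover, if N > M this identity also holds for μ = 1. -/

import Mathlib

open Finset

/-- Vandermonde product `V(x) = ∏_{1 ≤ b < a ≤ M} (x_a - x_b)`. -/
noncomputable def Vprod {M : ℕ} (x : Fin M → ℂ) : ℂ :=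
  ∏ a, ∏ b ∈ Finset.univ.filter (fun b => b < a), (x a - x b)

/-- The functional `𝒜^{ε}_{x}[f] = det[ x_a^{b-1} - f(x_a) (x_a + ε)^{b-1} ] / V(x)`;
`ε = η` gives `𝒜^{+}` and `ε = -η` gives `𝒜^{-}`. -/
noncomputable def Afun {M : ℕ} (x : Fin M → ℂ) (f : ℂ → ℂ) (ε : ℂ) : ℂ :=
  Matrix.det (Matrix.of fun a b : Fin M =>
    x a ^ (b : ℕ) - f (x a) * (x a + ε) ^ (b : ℕ)) / Vprod x

/-- `E^{ε}_{x}(z) = ∏_{n} (z - x_n + ε)/(z - x_n)`; `ε = η` gives `E^{+}` and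
`ε = -η` gives `E^{-}`. -/
noncomputable def Efun {M : ℕ} (x : Fin M → ℂ) (ε : ℂ) (z : ℂ) : ℂ :=
  ∏ n, (z - x n + ε) / (z - x n)

open Polynomial in
/-- A polynomial of degree less than `M + K` is the sum of its Lagrange interpolant at `M` nodes
and a multiple of the nodal polynomial by a polynomial of degree less than `K`. -/
lemma exists_eval_eq_interpolate_add_nodal_mul {M K : ℕ} {v : Fin M → ℂ}
    (hv : Function.Injective v) {f : ℂ[X]} (hf : f.degree < (M + K : ℕ)) :
    ∃ r : Fin K → ℂ, ∀ z, f.eval z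
      = ∑ b, (Lagrange.basis univ v b).eval z * f.eval (v b)
        + ∑ k : Fin K, ((Lagrange.nodal univ v).eval z * z ^ (k : ℕ)) * r k := by
  set g := Lagrange.interpolate univ v (fun b => f.eval (v b)) with hg
  have hgd : g.degree < (M : ℕ) := by
    simpa only [card_univ, Fintype.card_fin] using
      Lagrange.degree_interpolate_lt (s := univ) (fun b => f.eval (v b)) hv.injOn
  have hdvd : Lagrange.nodal univ v ∣ f - g := by
    refine Finset.prod_dvd_of_coprime
      (fun i _ j _ hij => pairwise_coprime_X_sub_C hv hij) fun b _ => ?_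
    rw [dvd_iff_isRoot, IsRoot, eval_sub, hg,
      Lagrange.eval_interpolate_at_node _ hv.injOn (mem_univ b), sub_self]
  obtain ⟨r, hr⟩ := hdvd
  refine ⟨fun k => r.coeff k, fun z => ?_⟩
  have hrz : r.eval z = ∑ k : Fin K, r.coeff k * z ^ (k : ℕ) := by
    rw [Fin.sum_univ_eq_sum_range (fun k => r.coeff k * z ^ k)]
    by_cases h0 : r = 0
    · simp [h0]
    have hd : (f - g).degree < (M + K : ℕ) :=
      (degree_sub_le _ _).trans_lt
        (max_lt hf (hgd.trans_le (by exact_mod_cast Nat.le_add_right M K)))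
    rw [hr, degree_mul, Lagrange.degree_nodal, degree_eq_natDegree h0, card_univ,
      Fintype.card_fin] at hd
    refine eval_eq_sum_range' ?_ z
    have : M + r.natDegree < M + K := by exact_mod_cast hd
    omega
  have hfz : f.eval z = g.eval z + (Lagrange.nodal univ v).eval z * r.eval z := by
    rw [← eval_mul, ← hr]; simp
  rw [hfz, hrz, hg, Lagrange.interpolate_apply, eval_finsetSum, mul_sum]
  congr 1
  · exact sum_congr rfl fun b _ => by rw [eval_mul, eval_C, mul_comm]
  · exact sum_congr rfl fun k _ => by ring

lemma Matrix.det_mul_mul_eq_of_equiv {R ι κ : Type*} [CommRing R] [Fintype ι] [DecidableEq ι]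
    [Fintype κ] [DecidableEq κ] (e : κ ≃ ι) (L : Matrix κ ι R) (A : Matrix ι ι R)
    (S : Matrix ι κ R) : (L * A * S).det = A.det * (L * S).det := by
  have h1 : L * A * S
      = L.submatrix id e * A.submatrix e e * S.submatrix e id := by
    simp [Matrix.submatrix_mul_equiv]
  have h2 : L * S = L.submatrix id e * S.submatrix e id := by
    simp [Matrix.submatrix_mul_equiv]
  rw [h1, h2, Matrix.det_mul, Matrix.det_mul, Matrix.det_mul, Matrix.det_submatrix_equiv_self]
  ring

lemma Vprod_eq_det_vandermonde {M : ℕ} (x : Fin M → ℂ) :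
    Vprod x = (Matrix.vandermonde x).det := by
  rw [Matrix.det_vandermonde, Vprod]
  simp only [prod_filter]
  rw [prod_comm]
  refine prod_congr rfl fun i _ => ?_
  rw [← prod_filter]
  refine prod_congr (by ext; simp) fun _ _ => rfl

lemma Vprod_ne_zero {M : ℕ} {x : Fin M → ℂ} (hx : Function.Injective x) : Vprod x ≠ 0 := by
  rw [Vprod_eq_det_vandermonde]
  exact Matrix.det_vandermonde_ne_zero_iff.2 hx

/-- `𝒜` is the Fredholm determinant of the map sending a polynomial `p` to the interpolant of
`f(z) p(z + ε)` at the nodes, in an arbitrary spanning family of polynomials. -/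
lemma Afun_eq_det_one_sub {N : ℕ} {ι : Type*} [Fintype ι] [DecidableEq ι] (e : Fin N ≃ ι)
    {y : Fin N → ℂ} (hy : Function.Injective y) (f : ℂ → ℂ) (ε μ : ℂ) (p : ι → ℂ → ℂ)
    (S : Matrix ι (Fin N) ℂ) (T : Matrix ι ι ℂ)
    (hS : ∀ z (i : Fin N), z ^ (i : ℕ) = ∑ j, p j z * S j i)
    (hT : ∀ a j, f (y a) * p j (y a + ε) = ∑ i, p i (y a) * T i j) :
    Afun y (fun z => μ * f z) ε = (1 - μ • T).det := by
  set L : Matrix (Fin N) ι ℂ := Matrix.of fun a j => p j (y a) with hL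
  have hW : Matrix.vandermonde y = L * S := by
    ext a i
    simp [Matrix.mul_apply, hL, hS (y a) i]
  have hW' : Matrix.of (fun a b : Fin N =>
      y a ^ (b : ℕ) - μ * f (y a) * (y a + ε) ^ (b : ℕ)) = L * (1 - μ • T) * S := by
    rw [Matrix.mul_sub, Matrix.sub_mul, Matrix.mul_one, ← hW]
    ext a i
    have : ∀ j, (L * T) a j = f (y a) * p j (y a + ε) := fun j => by
      simp [Matrix.mul_apply, hL, hT]
    simp only [Matrix.of_apply, Matrix.sub_apply, Matrix.vandermonde_apply, Matrix.mul_smul,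
      Matrix.smul_mul, Matrix.smul_apply, smul_eq_mul, Matrix.mul_apply (M := L * T), this,
      hS (y a + ε) i, mul_sum]
    congr 1
    exact sum_congr rfl fun j _ => by ring
  rw [Afun, hW', Matrix.det_mul_mul_eq_of_equiv e, ← hW, ← Vprod_eq_det_vandermonde,
    mul_div_cancel_right₀ _ (Vprod_ne_zero hy)]

open Polynomial in
lemma Afun_eq_det_lagrange {M : ℕ} {x : Fin M → ℂ} (hx : Function.Injective x) (f : ℂ → ℂ)
    (ε μ : ℂ) :
    Afun x (fun z => μ * f z) ε = (1 - μ • (Matrix.diagonal (fun a => f (x a)) *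
      Matrix.of fun a b => (Lagrange.basis univ x b).eval (x a + ε))).det := by
  refine Afun_eq_det_one_sub (Equiv.refl _) hx f ε μ (fun j z => (Lagrange.basis univ x j).eval z)
    (Matrix.of fun j i => x j ^ (i : ℕ)) _ (fun z i => ?_) fun a j => ?_
  · obtain ⟨r, hr⟩ := exists_eval_eq_interpolate_add_nodal_mul (K := 0) hx (f := X ^ (i : ℕ))
      (by rw [degree_X_pow]; exact_mod_cast i.2)
    simpa using hr z
  · rw [sum_eq_single a]
    · simp [Lagrange.eval_basis_self hx.injOn (mem_univ a), Matrix.diagonal_mul]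
    · intro b _ hb
      simp [Lagrange.eval_basis_of_ne hb (mem_univ a)]
    · simp

lemma Efun_eq_prod_div {M : ℕ} (x : Fin M → ℂ) (ε z : ℂ) :
    Efun x ε z = (Lagrange.nodal univ x).eval (z + ε) / (Lagrange.nodal univ x).eval z := by
  simp only [Efun, Lagrange.eval_nodal, prod_div_distrib]
  congr 1
  exact prod_congr rfl fun n _ => by ring

lemma sub_mul_eval_basis {M : ℕ} (v : Fin M → ℂ) (b : Fin M) (z : ℂ) :
    (z - v b) * (Lagrange.basis univ v b).eval z
      = Lagrange.nodalWeight univ v b * (Lagrange.nodal univ v).eval z := by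
  rw [Lagrange.basis_eq_prod_sub_inv_mul_nodal_div (mem_univ b),
    ← Lagrange.nodal_erase_eq_nodal_div (mem_univ b),
    Lagrange.nodal_eq_mul_nodal_erase (mem_univ b)]
  simp
  ring

lemma eval_basis_add_const {M : ℕ} (x : Fin M → ℂ) (η : ℂ) (b : Fin M) (z : ℂ) :
    (Lagrange.basis univ (fun c => x c + η) b).eval (z + η)
      = (Lagrange.basis univ x b).eval z := by
  simp [Lagrange.basis, Polynomial.eval_prod, Lagrange.basisDivisor]

lemma eval_nodal_add_const {M : ℕ} (x : Fin M → ℂ) (η z : ℂ) :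
    (Lagrange.nodal univ (fun c => x c + η)).eval z
      = (Lagrange.nodal univ x).eval (z - η) := by
  simp only [Lagrange.eval_nodal]
  exact prod_congr rfl fun _ _ => by ring

lemma eval_nodal_ne_zero {M : ℕ} {x : Fin M → ℂ} {z : ℂ} (h : ∀ a, x a ≠ z) :
    (Lagrange.nodal univ x).eval z ≠ 0 :=
  Lagrange.eval_nodal_not_at_node fun a _ => (h a).symm

open Polynomial in
/-- The polynomial interpolating `E⁻_x(z) ℓ_b(z)` at the nodes `y`, where `ℓ_b` is the Lagrange
basis at the nodes `x`, together with its values at the shifted nodes `x + η`. -/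
lemma exists_interpolant_Efun_mul_basis {M N : ℕ} (hMN : M ≤ N) (η : ℂ) {x : Fin M → ℂ}
    {y : Fin N → ℂ} (hx : Function.Injective x) (hxy : ∀ a b, x a ≠ y b) (b : Fin M) :
    ∃ g : ℂ[X], g.degree < N ∧
      (∀ a, Efun x (-η) (y a) * (Lagrange.basis univ x b).eval (y a) = g.eval (y a)) ∧
      ∀ c, g.eval (x c + η) = (Lagrange.nodalWeight univ x b / (Lagrange.nodal univ y).eval (x b))
        * (Lagrange.basis univ x c).eval (x b + -η)
        * ((Lagrange.nodal univ y).eval (x c + η) / Lagrange.nodalWeight univ x c) := by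
  set v : Fin M → ℂ := fun c => x c + η with hv
  have hPy : (Lagrange.nodal univ y).eval (x b) ≠ 0 := eval_nodal_ne_zero fun a => (hxy b a).symm
  set κ := (Lagrange.nodal univ x).eval (x b - η) / (Lagrange.nodal univ y).eval (x b) with hκ
  have hroot : X - C (x b) ∣ Lagrange.nodal univ v - C κ * Lagrange.nodal univ y := by
    rw [dvd_iff_isRoot, IsRoot, eval_sub, eval_mul, eval_C, eval_nodal_add_const, hκ,
      div_mul_cancel₀ _ hPy, sub_self]
  obtain ⟨h, hh⟩ := hroot
  have hev (z : ℂ) : (z - x b) * h.eval z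
      = (Lagrange.nodal univ x).eval (z - η) - κ * (Lagrange.nodal univ y).eval z := by
    rw [← eval_nodal_add_const]
    simpa using (congrArg (eval z) hh).symm
  have hw (c : Fin M) : Lagrange.nodalWeight univ x c ≠ 0 :=
    Lagrange.nodalWeight_ne_zero hx.injOn (mem_univ c)
  refine ⟨C (Lagrange.nodalWeight univ x b) * h, ?_, fun a => ?_, fun c => ?_⟩
  · rw [degree_C_mul (hw b)]
    by_cases h0 : h = 0
    · simp [h0]
    have hle : (Lagrange.nodal univ v - C κ * Lagrange.nodal univ y).degree ≤ (N : ℕ) := by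
      refine (degree_sub_le _ _).trans (max_le ?_ ((degree_mul_le _ _).trans ?_))
      · simpa [Lagrange.degree_nodal] using hMN
      · simpa [Lagrange.degree_nodal] using add_le_add_left (degree_C_le (a := κ)) (N : WithBot ℕ)
    rw [hh, degree_mul, degree_X_sub_C, degree_eq_natDegree h0] at hle
    rw [degree_eq_natDegree h0]
    have : 1 + h.natDegree ≤ N := by exact_mod_cast hle
    exact_mod_cast (by omega : h.natDegree < N)
  · have hPx : (Lagrange.nodal univ x).eval (y a) ≠ 0 := eval_nodal_ne_zero fun c => hxy c a
    have hne : y a - x b ≠ 0 := sub_ne_zero.2 (hxy b a).symm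
    have h1 := hev (y a)
    rw [Lagrange.eval_nodal_at_node (mem_univ a), mul_zero, sub_zero] at h1
    have h2 := sub_mul_eval_basis x b (y a)
    rw [Efun_eq_prod_div, ← sub_eq_add_neg, ← h1, eval_mul, eval_C, div_mul_eq_mul_div,
      div_eq_iff hPx]
    linear_combination h.eval (y a) * h2
  · rw [eval_mul, eval_C]
    by_cases hc : x b = x c + η
    · have h3 : h = Lagrange.nodal (univ.erase c) v := by
        have hκ0 : κ = 0 := by
          rw [hκ, hc, add_sub_cancel_right, Lagrange.eval_nodal_at_node (mem_univ c), zero_div]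
        refine mul_left_cancel₀ (X_sub_C_ne_zero (x b)) ?_
        rw [← hh, hκ0, hc, C_0, zero_mul, sub_zero]
        exact Lagrange.nodal_eq_mul_nodal_erase (v := v) (mem_univ c)
      have h4 : h.eval (x c + η) = (Lagrange.nodalWeight univ x c)⁻¹ := by
        rw [h3, Lagrange.nodalWeight_eq_eval_nodal_erase_inv, inv_inv]
        simp [Lagrange.eval_nodal, hv]
      rw [h4, show x b + -η = x c by rw [hc]; ring,
        Lagrange.eval_basis_self hx.injOn (mem_univ c), ← hc]
      field_simp
    · have hne : x c + η - x b ≠ 0 := sub_ne_zero.2 (Ne.symm hc)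
      have h1 := hev (x c + η)
      rw [add_sub_cancel_right, Lagrange.eval_nodal_at_node (mem_univ c), hκ] at h1
      have h2 := sub_mul_eval_basis x c (x b + -η)
      rw [← sub_eq_add_neg] at h2 ⊢
      have hwc := hw c
      have h3 : h.eval (x c + η) * (Lagrange.nodal univ y).eval (x b)
          * Lagrange.nodalWeight univ x c
          = (Lagrange.nodal univ y).eval (x c + η)
            * (Lagrange.basis univ x c).eval (x b - η) := by
        refine mul_left_cancel₀ hne ?_
        field_simp at h1
        linear_combination Lagrange.nodalWeight univ x c * h1
          + (Lagrange.nodal univ y).eval (x c + η) * h2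
      field_simp
      linear_combination Lagrange.nodalWeight univ x b * h3

lemma Afun_eq_pow_mul_Afun {M K : ℕ} (η μ : ℂ) {x : Fin M → ℂ} {y : Fin (M + K) → ℂ}
    (hx : Function.Injective x) (hy : Function.Injective y) (hxy : ∀ a b, x a ≠ y b) :
    Afun y (fun z => μ * Efun x (-η) z) η
      = (1 - μ) ^ K * Afun x (fun z => μ * Efun y η z) (-η) := by
  set v : Fin M → ℂ := fun c => x c + η with hv
  have hvi : Function.Injective v := fun a b h => hx (add_right_cancel h)
  set p : Fin M ⊕ Fin K → ℂ → ℂ := Sum.elim (fun b z => (Lagrange.basis univ v b).eval z)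
    (fun k z => (Lagrange.nodal univ v).eval z * z ^ (k : ℕ)) with hp
  choose r hr using fun i : Fin (M + K) =>
    exists_eval_eq_interpolate_add_nodal_mul (K := K) hvi (f := Polynomial.X ^ (i : ℕ))
      (by rw [Polynomial.degree_X_pow]; exact_mod_cast i.2)
  choose g hgdeg hgy hgx using
    exists_interpolant_Efun_mul_basis (Nat.le_add_right M K) η hx hxy
  choose s hs using fun b => exists_eval_eq_interpolate_add_nodal_mul hvi (hgdeg b)
  set A : Matrix (Fin M) (Fin M) ℂ := Matrix.of fun c b => (g b).eval (x c + η) with hA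
  set U : Matrix (Fin K) (Fin K) ℂ := Matrix.of fun i k =>
    ((Polynomial.X + Polynomial.C η) ^ (k : ℕ)).coeff i with hU
  have hdeg (k : ℕ) : ((Polynomial.X + Polynomial.C η) ^ k).natDegree = k := by simp
  have hUdet : (1 - μ • U).det = (1 - μ) ^ K := by
    rw [Matrix.det_of_isUpperTriangular]
    · have h1 (k : Fin K) : U k k = 1 := by
        have := (Polynomial.monic_X_add_C η).pow (k : ℕ)
        rw [Polynomial.Monic, Polynomial.leadingCoeff, hdeg] at this
        simpa [hU] using this
      simp [h1]
    · intro i k hik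
      have hlt : k < i := hik
      have : U i k = 0 :=
        Polynomial.coeff_eq_zero_of_natDegree_lt ((hdeg k).trans_lt (Fin.lt_def.1 hlt))
      simp [this, Matrix.one_apply_ne hlt.ne']
  have hAdet : (1 - μ • A).det = Afun x (fun z => μ * Efun y η z) (-η) := by
    set B : Matrix (Fin M) (Fin M) ℂ :=
      Matrix.of fun a b => (Lagrange.basis univ x b).eval (x a + -η)
    set D : Fin M → ℂ :=
      fun b => Lagrange.nodalWeight univ x b / (Lagrange.nodal univ y).eval (x b)
    set D' : Fin M → ℂ :=
      fun c => (Lagrange.nodal univ y).eval (x c + η) / Lagrange.nodalWeight univ x c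
    have hAt : A.transpose = (Matrix.diagonal D * B) * Matrix.diagonal D' := by
      ext b c
      simp [hA, hgx, Matrix.diagonal_mul, B, D, D']
    have hDD : Matrix.diagonal (fun a => Efun y η (x a))
        = Matrix.diagonal D' * Matrix.diagonal D := by
      rw [Matrix.diagonal_mul_diagonal]
      congr 1
      ext a
      have := Lagrange.nodalWeight_ne_zero hx.injOn (mem_univ a)
      simp only [D, D', Efun_eq_prod_div]
      field_simp
    rw [Afun_eq_det_lagrange hx, hDD, ← Matrix.det_transpose, Matrix.transpose_sub,
      Matrix.transpose_smul, Matrix.transpose_one, hAt, ← Matrix.smul_mul,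
      Matrix.det_one_sub_mul_comm, Matrix.mul_smul, Matrix.mul_assoc]
  have key := Afun_eq_det_one_sub finSumFinEquiv.symm hy (Efun x (-η)) η μ p
    (Matrix.of fun j i => Sum.elim (fun b => v b ^ (i : ℕ)) (fun k => r i k) j)
    (Matrix.fromBlocks A 0 (Matrix.of fun k b => s b k) U)
    (fun z i => by simpa [hp] using hr i z) ?_
  · rw [key, ← Matrix.fromBlocks_one, Matrix.fromBlocks_smul, sub_eq_add_neg,
      Matrix.fromBlocks_neg, Matrix.fromBlocks_add, smul_zero, neg_zero, add_zero,
      Matrix.det_fromBlocks_zero₁₂, ← sub_eq_add_neg, ← sub_eq_add_neg, hUdet, hAdet, mul_comm]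
  · rintro a (b | k)
    · simp only [hp, Sum.elim_inl, Fintype.sum_sum_type, Sum.elim_inr, Matrix.fromBlocks_apply₁₁,
        Matrix.fromBlocks_apply₂₁, hv, eval_basis_add_const]
      rw [hgy, hs]
      rfl
    · have hPx : (Lagrange.nodal univ x).eval (y a) ≠ 0 := eval_nodal_ne_zero fun c => hxy c a
      have hexp : (y a + η) ^ (k : ℕ) = ∑ i : Fin K, U i k * y a ^ (i : ℕ) := by
        have := Polynomial.eval_eq_sum_range' ((hdeg k).trans_lt k.2) (y a)
        rw [Finset.sum_range] at this
        simpa [hU] using this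
      simp only [hp, Sum.elim_inl, Fintype.sum_sum_type, Sum.elim_inr, Matrix.fromBlocks_apply₁₂,
        Matrix.fromBlocks_apply₂₂, Matrix.zero_apply, mul_zero, sum_const_zero, zero_add, hv,
        eval_nodal_add_const, Efun_eq_prod_div, add_sub_cancel_right, hexp, ← sub_eq_add_neg]
      rw [← mul_assoc, div_mul_cancel₀ _ hPx, mul_sum]
      exact sum_congr rfl fun i _ => by ring

theorem statement5 (M N : ℕ) (η : ℂ) (hη : η ≠ 0) (μ : ℂ)
    (x : Fin M → ℂ) (y : Fin N → ℂ)
    (hx : Function.Injective x) (hy : Function.Injective y)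
    (hxy : ∀ (a : Fin M) (b : Fin N), x a ≠ y b)
    (hμ : μ ≠ 1 ∨ N > M) :
    Afun y (fun z => μ * Efun x (-η) z) η
      = (1 - μ) ^ ((N : ℤ) - (M : ℤ)) * Afun x (fun z => μ * Efun y η z) (-η) := by
  rcases le_or_gt M N with hMN | hNM
  · obtain ⟨K, rfl⟩ := Nat.exists_eq_add_of_le hMN
    rw [Afun_eq_pow_mul_Afun η μ hx hy hxy]
    simp
  · obtain ⟨K, rfl⟩ := Nat.exists_eq_add_of_le hNM.le
    have hμ' : 1 - μ ≠ 0 := sub_ne_zero.2 (hμ.resolve_right (by omega)).symm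
    have h := Afun_eq_pow_mul_Afun (-η) μ hy hx (fun a b => (hxy b a).symm)
    rw [neg_neg] at h
    rw [h, ← mul_assoc, ← zpow_natCast, ← zpow_add₀ hμ']
    simp
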